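/- arXiv:2101.08862 — 2 statements merged into one kernel-verified Lean document; each statement's English description precedes it below -/
import Mathlib

section
/- Let w* : ℝ^K → ℝ^K be Lipschitz continuous with Lipschitz constant ϱ < 1 (with respect to the Euclidean norm) and let θ* be its (unique) fixed point. Suppose θ : [0, ∞) → ℝ^K is differentiable and satisfies the ODE θ'(t) = w*(θ(t)) − θ(t) for all t ≥ 0. Then for all t ≥ 0, ‖θ(t) − θ*‖ ≤ e^{−(1−ϱ)t} ‖θ(0) − θ*‖; in particular θ(t) → θ* as t → ∞, so θ* is globally asymptotically stable for this ODE. -/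
/-- exponential convergence for the target-network ODE
`θ'(t) = w*(θ(t)) − θ(t)` when `w*` is a contraction with constant `ϱ < 1` and
fixed point `θ*`: `‖θ(t) − θ*‖ ≤ e^{−(1−ϱ)t}‖θ(0) − θ*‖`, and `θ(t) → θ*`. -/
theorem ode_global_asymptotic_stability {K : ℕ}
    (wstar : EuclideanSpace ℝ (Fin K) → EuclideanSpace ℝ (Fin K))
    (ϱ : NNReal) (hϱ : (ϱ : ℝ) < 1) (hlip : LipschitzWith ϱ wstar)
    (θstar : EuclideanSpace ℝ (Fin K)) (hfix : wstar θstar = θstar)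
    (θ : ℝ → EuclideanSpace ℝ (Fin K))
    (hode : ∀ t : ℝ, 0 ≤ t →
      HasDerivWithinAt θ (wstar (θ t) - θ t) (Set.Ici (0 : ℝ)) t) :
    (∀ t : ℝ, 0 ≤ t →
        ‖θ t - θstar‖ ≤ Real.exp (-(1 - (ϱ : ℝ)) * t) * ‖θ 0 - θstar‖) ∧
      Filter.Tendsto θ Filter.atTop (nhds θstar) := by
  set c : ℝ := 1 - (ϱ : ℝ) with hc
  have hcpos : 0 < c := by rw [hc]; linarith
  have hder : ∀ t : ℝ, 0 ≤ t →
      HasDerivWithinAt (fun s => Real.exp (2 * c * s) * ‖θ s - θstar‖ ^ 2)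
        (Real.exp (2 * c * t) * (2 * c) * ‖θ t - θstar‖ ^ 2 +
          Real.exp (2 * c * t) * (2 * inner ℝ (θ t - θstar) (wstar (θ t) - θ t)))
        (Set.Ici (0 : ℝ)) t := by
    intro t ht
    have h1 : HasDerivWithinAt (fun s : ℝ => Real.exp (2 * c * s))
        (Real.exp (2 * c * t) * (2 * c)) (Set.Ici (0 : ℝ)) t := by
      have h := ((hasDerivAt_id t).const_mul (2 * c)).exp.hasDerivWithinAt (s := Set.Ici (0 : ℝ))
      simpa using h
    exact h1.mul ((hode t ht).sub_const θstar).norm_sq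
  have hanti : AntitoneOn (fun s => Real.exp (2 * c * s) * ‖θ s - θstar‖ ^ 2)
      (Set.Ici (0 : ℝ)) := by
    refine antitoneOn_of_hasDerivWithinAt_nonpos (convex_Ici 0)
      (fun t ht => (hder t ht).continuousWithinAt)
      (fun t ht => (hder t (interior_subset ht)).mono interior_subset) ?_
    intro t _
    have hl : ‖wstar (θ t) - θstar‖ ≤ ϱ * ‖θ t - θstar‖ := by
      have h := hlip.norm_sub_le (θ t) θstar
      rwa [hfix] at h
    have hi : inner ℝ (θ t - θstar) (wstar (θ t) - θ t) ≤ -c * ‖θ t - θstar‖ ^ 2 := by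
      have e : wstar (θ t) - θ t = (wstar (θ t) - θstar) - (θ t - θstar) := by abel
      rw [e, inner_sub_right, real_inner_self_eq_norm_sq]
      have h := real_inner_le_norm (θ t - θstar) (wstar (θ t) - θstar)
      have h2 := mul_le_mul_of_nonneg_left hl (norm_nonneg (θ t - θstar))
      rw [hc]
      nlinarith
    have he := Real.exp_pos (2 * c * t)
    have := mul_le_mul_of_nonneg_left hi he.le
    linarith
  have hbound : ∀ t : ℝ, 0 ≤ t →
      ‖θ t - θstar‖ ≤ Real.exp (-c * t) * ‖θ 0 - θstar‖ := by
    intro t ht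
    have h := hanti (Set.mem_Ici.2 le_rfl) (Set.mem_Ici.2 ht) ht
    simp only [mul_zero, Real.exp_zero, one_mul] at h
    have e : Real.exp (2 * c * t) = Real.exp (c * t) ^ 2 := by
      rw [← Real.exp_nat_mul]; congr 1; push_cast; ring
    rw [e, ← mul_pow] at h
    have h3 := le_trans (le_abs_self _) (abs_le_of_sq_le_sq h (norm_nonneg _))
    rw [neg_mul, Real.exp_neg, inv_mul_eq_div, le_div_iff₀ (Real.exp_pos _), mul_comm]
    exact h3
  refine ⟨hbound, ?_⟩
  rw [tendsto_iff_norm_sub_tendsto_zero]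
  have hz : Filter.Tendsto (fun t : ℝ => Real.exp (-c * t) * ‖θ 0 - θstar‖)
      Filter.atTop (nhds 0) := by
    have h : Filter.Tendsto (fun t : ℝ => Real.exp (-c * t)) Filter.atTop (nhds 0) :=
      Real.tendsto_exp_atBot.comp
        (Filter.tendsto_id.const_mul_atTop_of_neg (neg_lt_zero.2 hcpos))
    simpa using h.mul_const ‖θ 0 - θstar‖
  refine squeeze_zero' (Filter.Eventually.of_forall fun _ => norm_nonneg _) ?_ hz
  filter_upwards [Filter.eventually_ge_atTop (0 : ℝ)] with t ht using hbound t ht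
end

section
/- Let X be a real (nK) × K matrix with linearly independent columns (here n = |S||A| is the number of state–action pairs, abusing notation we write the row dimension as n), let D be an n × n diagonal matrix whose diagonal entries are positive and sum to 1, let P be an n × n row-stochastic matrix (nonnegative entries, each row summing to 1), let r ∈ ℝⁿ, let γ ∈ [0, 1), η > 0 and ξ ∈ (0, 1). Define ‖P‖_D := ‖D^{1/2} P D^{−1/2}‖ and define f : ℝ^K → ℝ^K by f(θ) = (Xᵀ D X + η I)⁻¹ Xᵀ D (r + γ P X θ). If γ ‖X‖ ‖P‖_D ≤ 2(1 − ξ)√η, then f is Lipschitz continuous with Lipschitz constant 1 − ξ (hence a contraction), f has a unique fixed point w*_η, and w*_η is the unique solution of (A + ηI)w = b, where A = Xᵀ D (I − γP) X and b = Xᵀ D r. -/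
open Matrix

/-- The operator norm of a real matrix induced by the Euclidean norms
(i.e., its largest singular value). -/
noncomputable def opNorm {m n : Type*} [Fintype m] [Fintype n] [DecidableEq n]
    (M : Matrix m n ℝ) : ℝ :=
  ‖LinearMap.toContinuousLinearMap (Matrix.toEuclideanLin M)‖

/-- The Euclidean norm of a plain vector. -/
noncomputable def evnorm {n : Type*} [Fintype n] (v : n → ℝ) : ℝ :=
  ‖(WithLp.equiv 2 (n → ℝ)).symm v‖

theorem le_of_sq_le_sq_aux {x y : ℝ} (h : x ^ 2 ≤ y ^ 2) (hy : 0 ≤ y) : x ≤ y :=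
  (abs_le_of_sq_le_sq' h hy).2

theorem evnorm_sq' {n : Type*} [Fintype n] (v : n → ℝ) : evnorm v ^ 2 = v ⬝ᵥ v := by
  unfold evnorm
  rw [EuclideanSpace.norm_sq_eq]
  simp [dotProduct, sq]

theorem evnorm_nonneg' {n : Type*} [Fintype n] (v : n → ℝ) : 0 ≤ evnorm v := norm_nonneg _

theorem evnorm_eq_zero' {n : Type*} [Fintype n] {v : n → ℝ} (h : evnorm v = 0) : v = 0 := by
  have := evnorm_sq' v
  rw [h] at this
  exact dotProduct_self_eq_zero.1 (by linarith)

theorem evnorm_zero' {n : Type*} [Fintype n] : evnorm (0 : n → ℝ) = 0 := by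
  have := evnorm_sq' (0 : n → ℝ)
  simpa using this

theorem evnorm_mulVec_le {m n : Type*} [Fintype m] [Fintype n] [DecidableEq n]
    (M : Matrix m n ℝ) (v : n → ℝ) : evnorm (M *ᵥ v) ≤ opNorm M * evnorm v :=
  ContinuousLinearMap.le_opNorm (LinearMap.toContinuousLinearMap (Matrix.toEuclideanLin M))
    ((WithLp.equiv 2 (n → ℝ)).symm v)

theorem dot_le_evnorm {n : Type*} [Fintype n] (u v : n → ℝ) :
    u ⬝ᵥ v ≤ evnorm u * evnorm v := by
  apply le_of_sq_le_sq_aux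
  · rw [mul_pow, evnorm_sq', evnorm_sq']
    have := Finset.sum_mul_sq_le_sq_mul_sq Finset.univ u v
    simpa [dotProduct, sq] using this
  · exact mul_nonneg (evnorm_nonneg' _) (evnorm_nonneg' _)

theorem td_key {n K : ℕ}
    (X : Matrix (Fin n) (Fin K) ℝ)
    (d : Fin n → ℝ) (hd : ∀ i, 0 < d i) (hdsum : ∑ i, d i = 1)
    (P : Matrix (Fin n) (Fin n) ℝ) {γ η ξ : ℝ} (hγ0 : 0 ≤ γ) (hη : 0 < η)
    (hξ1 : ξ < 1) (N : ℝ)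
    (hPD : N = opNorm (Matrix.diagonal (fun i => Real.sqrt (d i)) * P *
      Matrix.diagonal fun i => (Real.sqrt (d i))⁻¹))
    (hcond : γ * opNorm X * N ≤ 2 * (1 - ξ) * Real.sqrt η)
    (v θ : Fin K → ℝ)
    (h : (Xᵀ * diagonal d * X + η • (1 : Matrix (Fin K) (Fin K) ℝ)) *ᵥ v =
      γ • ((Xᵀ * diagonal d) *ᵥ (P *ᵥ (X *ᵥ θ)))) :
    evnorm v ≤ (1 - ξ) * evnorm θ := by
  set S : Matrix (Fin n) (Fin n) ℝ := diagonal (fun i => Real.sqrt (d i)) with hS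
  set Q := S * P * diagonal (fun i => (Real.sqrt (d i))⁻¹) with hQ
  have hSS : diagonal d = Sᵀ * S := by
    rw [hS, diagonal_transpose, diagonal_mul_diagonal]
    congr 1; funext i; exact (Real.mul_self_sqrt (hd i).le).symm
  have hQS : Q * S = S * P := by
    rw [hQ, Matrix.mul_assoc, hS, diagonal_mul_diagonal]
    have : (fun i => (Real.sqrt (d i))⁻¹ * Real.sqrt (d i)) = fun _ => (1:ℝ) := by
      funext i; exact inv_mul_cancel₀ (Real.sqrt_pos.2 (hd i)).ne'
    rw [this, diagonal_one, Matrix.mul_one]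
  have hadj : ∀ u : Fin n → ℝ, v ⬝ᵥ ((Xᵀ * diagonal d) *ᵥ u) =
      (S *ᵥ (X *ᵥ v)) ⬝ᵥ (S *ᵥ u) := by
    intro u
    rw [hSS, ← Matrix.mul_assoc, ← Matrix.transpose_mul, ← Matrix.mulVec_mulVec,
      Matrix.dotProduct_mulVec, Matrix.vecMul_transpose, Matrix.mulVec_mulVec]
  set a := S *ᵥ (X *ᵥ v) with ha
  set b := S *ᵥ (X *ᵥ θ) with hb
  have hmain : evnorm a ^ 2 + η * evnorm v ^ 2 = γ * (a ⬝ᵥ (Q *ᵥ b)) := by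
    have h2 := congrArg (fun u => v ⬝ᵥ u) h
    simp only [Matrix.add_mulVec, dotProduct_add, Matrix.smul_mulVec, Matrix.one_mulVec,
      dotProduct_smul, smul_eq_mul] at h2
    rw [← Matrix.mulVec_mulVec, hadj, hadj] at h2
    rw [evnorm_sq', evnorm_sq', hb, Matrix.mulVec_mulVec, hQS, ← Matrix.mulVec_mulVec]
    exact h2
  have hbX : evnorm b ≤ opNorm X * evnorm θ := by
    refine le_trans ?_ (evnorm_mulVec_le X θ)
    refine le_of_sq_le_sq_aux ?_ (evnorm_nonneg' _)
    rw [evnorm_sq', evnorm_sq']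
    apply Finset.sum_le_sum
    intro i _
    have hdi : d i ≤ 1 := by
      rw [← hdsum]
      exact Finset.single_le_sum (fun j _ => (hd j).le) (Finset.mem_univ i)
    have e : b i = Real.sqrt (d i) * (X *ᵥ θ) i := by rw [hb, hS, mulVec_diagonal]
    rw [e]
    have := Real.mul_self_sqrt (hd i).le
    calc _ = d i * ((X *ᵥ θ) i * (X *ᵥ θ) i) := by rw [← this]; ring_nf; rw [Real.sqrt_sq (Real.sqrt_nonneg _)]
      _ ≤ _ := mul_le_of_le_one_left (mul_self_nonneg _) hdi
  have hN : 0 ≤ N := by rw [hPD]; exact norm_nonneg _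
  have h1 : γ * (a ⬝ᵥ (Q *ᵥ b)) ≤ evnorm a * (2 * (1 - ξ) * Real.sqrt η * evnorm θ) := by
    calc γ * (a ⬝ᵥ (Q *ᵥ b)) ≤ γ * (evnorm a * (N * (opNorm X * evnorm θ))) := by
          apply mul_le_mul_of_nonneg_left _ hγ0
          refine (dot_le_evnorm _ _).trans (mul_le_mul_of_nonneg_left ?_ (evnorm_nonneg' _))
          refine (evnorm_mulVec_le Q b).trans ?_
          rw [← hPD]
          exact mul_le_mul_of_nonneg_left hbX hN
      _ = evnorm a * ((γ * opNorm X * N) * evnorm θ) := by ring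
      _ ≤ _ := mul_le_mul_of_nonneg_left
        (mul_le_mul_of_nonneg_right hcond (evnorm_nonneg' _)) (evnorm_nonneg' _)
  have hsq := Real.sq_sqrt hη.le
  refine le_of_sq_le_sq_aux ?_ (mul_nonneg (by linarith) (evnorm_nonneg' _))
  refine le_of_mul_le_mul_left ?_ hη
  have h3 := sq_nonneg (evnorm a - (1 - ξ) * Real.sqrt η * evnorm θ)
  have h4 : η * ((1 - ξ) * evnorm θ) ^ 2 = ((1 - ξ) * Real.sqrt η * evnorm θ) ^ 2 := by
    rw [mul_pow, mul_pow, mul_pow, hsq]; ring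
  rw [h4]
  nlinarith

/-- under `γ‖X‖‖P‖_D ≤ 2(1 − ξ)√η`, the regularized TD operator
`f(θ) = (XᵀDX + ηI)⁻¹XᵀD(r + γPXθ)` is a contraction with constant `1 − ξ`, it has a
unique fixed point, and the fixed points of `f` are exactly the solutions of
`(A + ηI)w = b` with `A = XᵀD(I − γP)X`, `b = XᵀDr`. -/
theorem regularized_td_operator_contraction {n K : ℕ}
    (X : Matrix (Fin n) (Fin K) ℝ)
    (hX : LinearIndependent ℝ (fun j : Fin K => fun i : Fin n => X i j))
    (d : Fin n → ℝ) (hd : ∀ i, 0 < d i) (hdsum : ∑ i, d i = 1)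
    (P : Matrix (Fin n) (Fin n) ℝ) (hP0 : ∀ i j, 0 ≤ P i j) (hP1 : ∀ i, ∑ j, P i j = 1)
    (r : Fin n → ℝ) {γ η ξ : ℝ} (hγ0 : 0 ≤ γ) (hγ1 : γ < 1) (hη : 0 < η)
    (hξ0 : 0 < ξ) (hξ1 : ξ < 1)
    (D : Matrix (Fin n) (Fin n) ℝ) (hD : D = Matrix.diagonal d)
    (normPD : ℝ)
    (hPD : normPD = opNorm (Matrix.diagonal (fun i => Real.sqrt (d i)) * P *
      Matrix.diagonal fun i => (Real.sqrt (d i))⁻¹))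
    (hcond : γ * opNorm X * normPD ≤ 2 * (1 - ξ) * Real.sqrt η)
    (f : (Fin K → ℝ) → Fin K → ℝ)
    (hf : ∀ θ, f θ = (Xᵀ * D * X + η • (1 : Matrix (Fin K) (Fin K) ℝ))⁻¹.mulVec
      ((Xᵀ * D).mulVec (r + γ • P.mulVec (X.mulVec θ)))) :
    (∀ θ₁ θ₂, evnorm (f θ₁ - f θ₂) ≤ (1 - ξ) * evnorm (θ₁ - θ₂)) ∧
      (∃! w, f w = w) ∧
      ∀ w, f w = w ↔
        (Xᵀ * D * (1 - γ • P) * X + η • (1 : Matrix (Fin K) (Fin K) ℝ)).mulVec w =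
          (Xᵀ * D).mulVec r := by
  subst hD
  set M := Xᵀ * diagonal d * X + η • (1 : Matrix (Fin K) (Fin K) ℝ) with hM
  have key := fun v θ => td_key X d hd hdsum P hγ0 hη hξ1 normPD hPD hcond v θ
  have hMu : IsUnit M := by
    rw [← Matrix.mulVec_injective_iff_isUnit, ← Matrix.coe_mulVecLin,
      injective_iff_map_eq_zero]
    intro v hv
    have := key v 0 (by simpa using hv)
    rw [evnorm_zero', mul_zero] at this
    exact evnorm_eq_zero' (le_antisymm this (evnorm_nonneg' _))
  have hdet : IsUnit M.det := (Matrix.isUnit_iff_isUnit_det M).1 hMu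
  have hMf : ∀ θ, M *ᵥ f θ = (Xᵀ * diagonal d) *ᵥ (r + γ • P *ᵥ (X *ᵥ θ)) := by
    intro θ
    rw [hf, Matrix.mulVec_mulVec, Matrix.mul_nonsing_inv _ hdet, Matrix.one_mulVec]
  have hB : ∀ w, (Xᵀ * diagonal d * (1 - γ • P) * X + η • (1 : Matrix (Fin K) (Fin K) ℝ)) *ᵥ w
      = M *ᵥ w - γ • ((Xᵀ * diagonal d) *ᵥ (P *ᵥ (X *ᵥ w))) := by
    intro w
    simp only [hM, Matrix.mul_sub, Matrix.sub_mul, Matrix.add_mulVec, Matrix.sub_mulVec,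
      Matrix.mul_one, Matrix.mul_smul, Matrix.smul_mul, Matrix.smul_mulVec,
      Matrix.mulVec_mulVec, Matrix.mul_assoc]
    abel
  have hiff : ∀ w, f w = w ↔
        (Xᵀ * diagonal d * (1 - γ • P) * X + η • (1 : Matrix (Fin K) (Fin K) ℝ)).mulVec w =
          (Xᵀ * diagonal d).mulVec r := by
    intro w
    rw [hB, sub_eq_iff_eq_add, ← (Matrix.mulVec_injective_of_isUnit hMu).eq_iff, hMf,
      Matrix.mulVec_add, Matrix.mulVec_smul]
    exact eq_comm
  refine ⟨?_, ?_, hiff⟩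
  · intro θ₁ θ₂
    apply key
    rw [Matrix.mulVec_sub, hMf, hMf]
    simp only [Matrix.mulVec_add, Matrix.mulVec_smul, Matrix.mulVec_sub, smul_sub]
    abel
  · simp only [hiff]
    have hBu : IsUnit (Xᵀ * diagonal d * (1 - γ • P) * X +
        η • (1 : Matrix (Fin K) (Fin K) ℝ)) := by
      rw [← Matrix.mulVec_injective_iff_isUnit, ← Matrix.coe_mulVecLin,
        injective_iff_map_eq_zero]
      intro v hv
      rw [Matrix.mulVecLin_apply, hB, sub_eq_zero] at hv
      have := key v v hv
      have h0 := evnorm_nonneg' v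
      exact evnorm_eq_zero' (by nlinarith)
    exact Function.Bijective.existsUnique ⟨Matrix.mulVec_injective_iff_isUnit.2 hBu,
      Matrix.mulVec_surjective_iff_isUnit.2 hBu⟩ _
end
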